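/- In any alternative algebra over a field of characteristic 0, ([a^2,z],[a,t],u) = ([a,z],[a^2,t],u) and ([[a^2,z],t],a,u) = ([[a,z],t],a^2,u), where [a,b] = ab - ba and (x,y,z) = (xy)z - x(yz). -/

import Mathlib

variable {A : Type*} [NonUnitalNonAssocRing A]

/-- Commutator `[x,y] = xy - yx`. -/
def altComm (x y : A) : A := x * y - y * x

/-- Associator `(x,y,z) = (xy)z - x(yz)`. -/
def altAssoc (x y z : A) : A := (x * y) * z - x * (y * z)

/-- Jordan product `x ∘ y = xy + yx`. -/
def altSop (x y : A) : A := x * y + y * x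

/-- Jacobian `J(a,b,c) = [[a,b],c] + [[b,c],a] + [[c,a],b]`. -/
def altJac (x y z : A) : A := altComm (altComm x y) z + altComm (altComm y z) x + altComm (altComm z x) y

/-- `D(a,b,c) = (a∘b)∘c - (a∘c)∘b`. -/
def altDop (x y z : A) : A := altSop (altSop x y) z - altSop (altSop x z) y

theorem aux_swap12 (hl : ∀ x y : A, altAssoc x x y = 0) (x y z : A) :
    altAssoc x y z = - altAssoc y x z := by
  have h := hl (x + y) z
  have h1 := hl x z
  have h2 := hl y z
  have e : altAssoc (x + y) (x + y) z
      = altAssoc x x z + altAssoc x y z + altAssoc y x z + altAssoc y y z := by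
    simp only [altAssoc, add_mul, mul_add]; abel
  rw [e, h1, h2, zero_add, add_zero] at h
  exact eq_neg_of_add_eq_zero_left h

theorem aux_swap23 (hr : ∀ x y : A, altAssoc y x x = 0) (x y z : A) :
    altAssoc x y z = - altAssoc x z y := by
  have h := hr (y + z) x
  have h1 := hr y x
  have h2 := hr z x
  have e : altAssoc x (y + z) (y + z)
      = altAssoc x y y + altAssoc x y z + altAssoc x z y + altAssoc x z z := by
    simp only [altAssoc, add_mul, mul_add]; abel
  rw [e, h1, h2, zero_add, add_zero] at h
  exact eq_neg_of_add_eq_zero_left h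

theorem aux_teich (w x y z : A) :
    altAssoc (w * x) y z - altAssoc w (x * y) z + altAssoc w x (y * z)
      = w * altAssoc x y z + altAssoc w x y * z := by
  simp only [altAssoc, sub_mul, mul_sub]; abel

/-- `(x², y, z) = (x, yx, z) + (x,y,z) x`. -/
theorem aux_sqA (hl : ∀ x y : A, altAssoc x x y = 0) (hr : ∀ x y : A, altAssoc y x x = 0)
    (x y z : A) : altAssoc (x * x) y z = altAssoc x (y * x) z + altAssoc x y z * x := by
  have s12 := aux_swap12 hl
  have s23 := aux_swap23 hr
  have T := aux_teich z y x x
  rw [hr, hr, mul_zero, s12 z (y * x) x, s23 (y * x) z x, s12 (y * x) x z,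
    s23 z y (x * x), s12 z (x * x) y, s23 (x * x) z y,
    s12 z y x, s23 y z x, s12 y x z] at T
  simp only [neg_neg, neg_mul, zero_sub, zero_add] at T
  rw [← neg_neg (altAssoc x y z * x), ← T]; abel

/-- `(x², y, z) = (x, xy, z) + x (x,y,z)`. -/
theorem aux_sqB (hl : ∀ x y : A, altAssoc x x y = 0)
    (x y z : A) : altAssoc (x * x) y z = altAssoc x (x * y) z + x * altAssoc x y z := by
  have T := aux_teich x x y z
  rw [hl, hl, zero_mul] at T
  simp only [add_zero] at T
  rw [← T]; abel

theorem aux_sqC (hl : ∀ x y : A, altAssoc x x y = 0) (hr : ∀ x y : A, altAssoc y x x = 0)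
    (x y z : A) : altAssoc (x * x) y z = altAssoc x (y * x) z + altAssoc x y (x * z) := by
  have s12 := aux_swap12 hl
  have T := aux_teich y x x z
  rw [hr, hl, mul_zero, zero_mul, s12 (y * x) x z, s12 y (x * x) z, s12 y x (x * z)] at T
  have e : altAssoc (x * x) y z - (altAssoc x (y * x) z + altAssoc x y (x * z)) = 0 := by
    rw [← add_zero (0 : A), ← T]; abel
  exact sub_eq_zero.mp e

theorem aux_right (hl : ∀ x y : A, altAssoc x x y = 0) (hr : ∀ x y : A, altAssoc y x x = 0)
    (x y z : A) : altAssoc x (y * x) z = x * altAssoc x y z := by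
  have s23 := aux_swap23 hr
  have B := aux_sqB hl x z y
  rw [s23 (x * x) z y, s23 x (x * z) y, s23 x z y, aux_sqC hl hr x y z, mul_neg] at B
  have B2 := neg_inj.mp (B.trans (neg_add _ _).symm)
  rw [add_comm] at B2
  exact add_left_cancel B2

theorem aux_sq (hl : ∀ x y : A, altAssoc x x y = 0) (hr : ∀ x y : A, altAssoc y x x = 0)
    (x y z : A) : altAssoc (x * x) y z = altSop x (altAssoc x y z) := by
  rw [aux_sqA hl hr, aux_right hl hr]; rfl

theorem aux_left (hl : ∀ x y : A, altAssoc x x y = 0) (hr : ∀ x y : A, altAssoc y x x = 0)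
    (x y z : A) : altAssoc x (x * y) z = altAssoc x y z * x := by
  have h := aux_sqB hl x y z
  rw [aux_sq hl hr, altSop, add_comm] at h
  exact (add_right_cancel h).symm

/-- `(a,[a,z],u) = -[a,(a,z,u)]`. -/
theorem aux_D (hl : ∀ x y : A, altAssoc x x y = 0) (hr : ∀ x y : A, altAssoc y x x = 0)
    (a z u : A) : altAssoc a (altComm a z) u = - altComm a (altAssoc a z u) := by
  have e : altAssoc a (altComm a z) u = altAssoc a (a * z) u - altAssoc a (z * a) u := by
    simp only [altAssoc, altComm, sub_mul, mul_sub]; abel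
  rw [e, aux_left hl hr, aux_right hl hr, altComm]; abel

theorem aux_sop1 (hl : ∀ x y : A, altAssoc x x y = 0) (hr : ∀ x y : A, altAssoc y x x = 0)
    (x y b u : A) :
    altAssoc (altSop x y) b u = altSop x (altAssoc y b u) + altSop y (altAssoc x b u) := by
  have h := aux_sq hl hr (x + y) b u
  have e : altAssoc ((x + y) * (x + y)) b u
      = altAssoc (x * x) b u + altAssoc (altSop x y) b u + altAssoc (y * y) b u := by
    simp only [altAssoc, altSop, add_mul, mul_add]; abel
  have e2 : altSop (x + y) (altAssoc (x + y) b u)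
      = altSop x (altAssoc x b u) + (altSop x (altAssoc y b u) + altSop y (altAssoc x b u))
        + altSop y (altAssoc y b u) := by
    have : altAssoc (x + y) b u = altAssoc x b u + altAssoc y b u := by
      simp only [altAssoc, add_mul]; abel
    rw [this]
    simp only [altSop, add_mul, mul_add]; abel
  rw [e, e2, aux_sq hl hr, aux_sq hl hr] at h
  exact add_left_cancel (add_right_cancel h)

theorem altSop_neg' (x y : A) : altSop x (-y) = - altSop x y := by
  simp only [altSop, mul_neg, neg_mul]; abel

theorem altSop_comm' (x y : A) : altSop x y = altSop y x := add_comm _ _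

theorem aux_sop2 (hl : ∀ x y : A, altAssoc x x y = 0) (hr : ∀ x y : A, altAssoc y x x = 0)
    (x y b u : A) :
    altAssoc b (altSop x y) u = altSop x (altAssoc b y u) + altSop y (altAssoc b x u) := by
  have s12 := aux_swap12 hl
  rw [s12 b, aux_sop1 hl hr, s12 b y, s12 b x, altSop_neg', altSop_neg']; abel

/-- `ad a` is a derivation of the Jordan product. -/
theorem aux_der (hl : ∀ x y : A, altAssoc x x y = 0) (hr : ∀ x y : A, altAssoc y x x = 0)
    (a x y : A) :
    altComm a (altSop x y) = altSop (altComm a x) y + altSop x (altComm a y) := by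
  have s12 := aux_swap12 hl
  have s23 := aux_swap23 hr
  have e : altComm a (altSop x y) - (altSop (altComm a x) y + altSop x (altComm a y))
      = - altAssoc a x y + altAssoc x a y - altAssoc x y a
        - altAssoc a y x + altAssoc y a x - altAssoc y x a := by
    simp only [altAssoc, altSop, altComm, add_mul, mul_add, sub_mul, mul_sub]; abel
  rw [s12 x a y, s23 x y a, s12 x a y, s23 a y x, s12 y a x, s23 a y x, s23 y x a, s12 y a x,
    s23 a y x] at e
  apply sub_eq_zero.mp
  rw [e]; abel

theorem aux_two {F : Type*} [Field F] [CharZero F] [Module F A] (q : A) (h : q + q = 0) :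
    q = 0 := by
  rw [← two_smul F q] at h
  exact (smul_eq_zero.mp h).resolve_left two_ne_zero

/-- `[a,z]∘(a,t,u) + [a,t]∘(a,z,u) = 0`. -/
theorem aux_E1 {F : Type*} [Field F] [CharZero F] [Module F A]
    (hl : ∀ x y : A, altAssoc x x y = 0) (hr : ∀ x y : A, altAssoc y x x = 0)
    (a z t u : A) :
    altSop (altComm a z) (altAssoc a t u) + altSop (altComm a t) (altAssoc a z u) = 0 := by
  have h := aux_D hl hr a (altSop z t) u
  have c : ∀ x y : A, altComm a (x + y) = altComm a x + altComm a y := by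
    intro x y; simp only [altComm, add_mul, mul_add]; abel
  have c2 : ∀ x y : A, altAssoc a (x + y) u = altAssoc a x u + altAssoc a y u := by
    intro x y; simp only [altAssoc, add_mul, mul_add]; abel
  rw [aux_der hl hr, c2, aux_sop2 hl hr, aux_sop2 hl hr, aux_sop2 hl hr, c, aux_der hl hr,
    aux_der hl hr, aux_D hl hr, aux_D hl hr, altSop_neg', altSop_neg'] at h
  apply aux_two (F := F)
  have h2 := sub_eq_zero.mpr h
  rw [← h2]
  abel

theorem aux_core {F : Type*} [Field F] [CharZero F] [Module F A]
    (hl : ∀ x y : A, altAssoc x x y = 0) (hr : ∀ x y : A, altAssoc y x x = 0)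
    (a z t u : A) :
    altSop (altComm a z) (altAssoc a (altComm a t) u)
      + altSop (altComm a t) (altAssoc a (altComm a z) u) = 0 := by
  have h0 := congrArg (altComm a) (aux_E1 (F := F) hl hr a z t u)
  have h1 := aux_E1 (F := F) hl hr a (altComm a z) t u
  have h2 := aux_E1 (F := F) hl hr a z (altComm a t) u
  have c : ∀ x y : A, altComm a (x + y) = altComm a x + altComm a y := by
    intro x y; simp only [altComm, add_mul, mul_add]; abel
  have c0 : altComm a 0 = 0 := by simp [altComm]
  rw [c, c0, aux_der hl hr, aux_der hl hr] at h0
  simp only [aux_D hl hr, altSop_neg'] at h1 h2 ⊢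
  apply aux_two (F := F)
  have h3 : _ + _ - _ = (0 : A) + 0 - 0 := congrArg₂ (· - ·) (congrArg₂ (· + ·) h1 h2) h0
  rw [add_zero, sub_zero] at h3
  rw [← h3]
  abel

theorem stmt_19 {F : Type*} [Field F] [CharZero F]
    [Module F A] [SMulCommClass F A A] [IsScalarTower F A A]
    (alt_left : ∀ x y : A, altAssoc x x y = 0)
    (alt_right : ∀ x y : A, altAssoc y x x = 0)
    (a z t u : A) :
    altAssoc (altComm (a * a) z) (altComm a t) u = altAssoc (altComm a z) (altComm (a * a) t) u ∧ altAssoc (altComm (altComm (a * a) z) t) a u = altAssoc (altComm (altComm a z) t) (a * a) u := by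
  have s12 := aux_swap12 alt_left
  have core := aux_core (F := F) alt_left alt_right a z t u
  have sq : ∀ z : A, altComm (a * a) z = altSop a (altComm a z) := by
    intro z
    have h1 := alt_left a z
    have h2 := alt_right a z
    have h3 := s12 a z a
    have h4 := aux_swap23 alt_right a z a
    rw [alt_left, neg_zero] at h4
    have e : altComm (a * a) z - altSop a (altComm a z)
        = altAssoc a a z + altAssoc z a a - altAssoc a z a := by
      simp only [altAssoc, altSop, altComm, sub_mul, mul_sub]; abel
    rw [h1, h2, h4] at e
    simp only [sub_zero, add_zero] at e
    exact sub_eq_zero.mp e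
  constructor
  · rw [sq, sq, aux_sop1 alt_left alt_right, aux_sop2 alt_left alt_right,
      s12 (altComm a z) a u, altSop_neg']
    congr 1
    exact eq_neg_of_add_eq_zero_left core
  · have cneg : ∀ x : A, altComm x t = - altComm t x := by
      intro x; simp only [altComm]; abel
    have e : altComm (altSop a (altComm a z)) t
        = altSop (altComm a t) (altComm a z) + altSop a (altComm (altComm a z) t) := by
      rw [cneg, aux_der alt_left alt_right, cneg a, cneg (altComm a z), altSop_neg',
        altSop_comm' (-altComm t a), altSop_neg', altSop_comm' (altComm a z)]
      abel
    have c2 : ∀ x y : A, altAssoc (x + y) a u = altAssoc x a u + altAssoc y a u := by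
      intro x y; simp only [altAssoc, add_mul]; abel
    rw [sq, e, c2, aux_sop1 alt_left alt_right, aux_sop1 alt_left alt_right, alt_left,
      s12 _ (a * a) u, aux_sq alt_left alt_right, s12 (altComm a z) a u,
      s12 (altComm a t) a u, s12 (altComm (altComm a z) t) a u]
    simp only [altSop_neg']
    have z0 : altSop (altComm (altComm a z) t) 0 = 0 := by simp [altSop]
    rw [z0, ← neg_add, add_comm (altSop (altComm a t) _), core]
    abel
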